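/- arXiv:2511.23472 — 2 statements merged into one kernel-verified Lean document; each statement's English description precedes it below -/
import Mathlib

section
/- Sum-frame entailment: for all SL propositions P, Q, R, the entailment (P + Q) * R ⊢ (P * R) + (Q * R) holds. -/
open scoped Classical

noncomputable section

namespace QSL

/-! ## Resources -/

/-- Vectors over the Hilbert space with orthonormal basis indexed by `Q → {0,1}`. -/
def Vec {Qubit : Type} (Q : Finset Qubit) : Type := ({ q // q ∈ Q } → Bool) → ℂ

/-- A quantum state: a finite set of qubits together with a vector over them. -/
def QState (Qubit : Type) : Type := Σ Q : Finset Qubit, Vec Q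

/-- A store: a partial function from variables to values. -/
def Store (Var Val : Type) : Type := Var → Option Val

/-- A resource: a quantum state together with a store. -/
def Res (Qubit Var Val : Type) : Type := QState Qubit × Store Var Val

variable {Qubit Var Val : Type}

/-- Tensor product of vectors over disjoint qubit sets. -/
def tensorVec {Q Q' : Finset Qubit} (v : Vec Q) (w : Vec Q') : Vec (Q ∪ Q') := fun f =>
  v (fun q => f ⟨q.1, Finset.mem_union_left _ q.2⟩) *
  w (fun q => f ⟨q.1, Finset.mem_union_right _ q.2⟩)

/-- Transport of a vector along an equality of qubit sets. -/
def castVec {Q Q' : Finset Qubit} (h : Q = Q') (v : Vec Q) : Vec Q' := h ▸ v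

/-- The empty quantum state with scalar 1. -/
def unitQ : QState Qubit := ⟨(∅ : Finset Qubit), fun _ => 1⟩

/-- The unit resource: empty qubit set with scalar 1 and the empty store. -/
def unitRes : Res Qubit Var Val := (unitQ, fun _ => none)

/-- Partial product of resources: defined iff the qubit sets are disjoint and
the store domains are disjoint; takes the union of qubit sets, tensor product of
vectors, and union of stores. -/
def rmul (a b : Res Qubit Var Val) : Option (Res Qubit Var Val) :=
  if h : Disjoint a.1.1 b.1.1 ∧ ∀ x, a.2 x = none ∨ b.2 x = none then
    some (⟨a.1.1 ∪ b.1.1, tensorVec a.1.2 b.1.2⟩, fun x => a.2 x <|> b.2 x)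
  else none

/-- Partial sum of resources: defined iff the two resources have the same
qubit set and the same store; adds the vectors. -/
def radd (a b : Res Qubit Var Val) : Option (Res Qubit Var Val) :=
  if h : a.1.1 = b.1.1 ∧ a.2 = b.2 then
    some (⟨b.1.1, fun f => castVec h.1 a.1.2 f + b.1.2 f⟩, b.2)
  else none

/-- Incompatibility of resources: some variable lies in both store domains and
the stores disagree on it. -/
def incompat (a b : Res Qubit Var Val) : Prop :=
  ∃ x u u', a.2 x = some u ∧ b.2 x = some u' ∧ u ≠ u'

/-! ## Multisets (possibly infinite, as families up to bijective reindexing) -/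

/-- An indexed family representing a multiset. -/
structure PreMSet (A : Type) : Type 1 where
  idx : Type
  val : idx → A

/-- Equivalence of indexed families by bijective reindexing. -/
def msetEquiv {A : Type} (f g : PreMSet A) : Prop :=
  ∃ e : f.idx ≃ g.idx, ∀ i, f.val i = g.val (e i)

theorem msetEquiv_refl {A : Type} (f : PreMSet A) : msetEquiv f f :=
  ⟨Equiv.refl _, fun _ => rfl⟩

theorem msetEquiv_symm {A : Type} {f g : PreMSet A} : msetEquiv f g → msetEquiv g f
  | ⟨e, h⟩ => ⟨e.symm, fun i => by rw [h (e.symm i), Equiv.apply_symm_apply]⟩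

theorem msetEquiv_trans {A : Type} {f g k : PreMSet A} :
    msetEquiv f g → msetEquiv g k → msetEquiv f k
  | ⟨e, h⟩, ⟨e', h'⟩ => ⟨e.trans e', fun i => (h i).trans (h' (e i))⟩

instance msetSetoid (A : Type) : Setoid (PreMSet A) :=
  ⟨msetEquiv, ⟨msetEquiv_refl, msetEquiv_symm, msetEquiv_trans⟩⟩

/-- Multisets over `A`: families up to bijective reindexing. -/
def MSet (A : Type) : Type 1 := Quotient (msetSetoid A)

def MSet.mk {A : Type} (I : Type) (f : I → A) : MSet A :=
  Quotient.mk (msetSetoid A) ⟨I, f⟩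

/-- A canonical representative family of a multiset. -/
def MSet.out {A : Type} (m : MSet A) : PreMSet A := Quotient.out m

/-- `a` is an occurrence of the multiset `m`. -/
def MSet.MemM {A : Type} (a : A) (m : MSet A) : Prop := ∃ i, m.out.val i = a

def MSet.map {A B : Type} (f : A → B) (m : MSet A) : MSet B :=
  MSet.mk m.out.idx (fun i => f (m.out.val i))

/-- Sum (disjoint union) of two multisets. -/
def MSet.uplus {A : Type} (m m' : MSet A) : MSet A :=
  MSet.mk (m.out.idx ⊕ m'.out.idx) (Sum.elim m.out.val m'.out.val)

/-- Indexed sum (disjoint union) of a family of multisets. -/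
def MSet.biguplus {A : Type} (I : Type) (f : I → MSet A) : MSet A :=
  MSet.mk (Σ x : I, (f x).out.idx) (fun p => (f p.1).out.val p.2)


/-- Partial product of multisets of resources: an occurrence `a·b` for every
pair of occurrences, defined iff all these resource products are defined. -/
def mprodM (m m' : MSet (Res Qubit Var Val)) : Option (MSet (Res Qubit Var Val)) :=
  if h : ∀ (i : m.out.idx) (j : m'.out.idx), (rmul (m.out.val i) (m'.out.val j)).isSome then
    some (MSet.mk (m.out.idx × m'.out.idx)
      (fun p => (rmul (m.out.val p.1) (m'.out.val p.2)).get (h p.1 p.2)))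
  else none

/-- Sum of the two projections of a multiset of pairs of resources (the
multiset of pairs plays the role of a multiset bijection between its two
projections): defined iff all the componentwise resource sums are defined. -/
def msumr (r : MSet (Res Qubit Var Val × Res Qubit Var Val)) :
    Option (MSet (Res Qubit Var Val)) :=
  if h : ∀ i, (radd (r.out.val i).1 (r.out.val i).2).isSome then
    some (MSet.mk r.out.idx (fun i => (radd (r.out.val i).1 (r.out.val i).2).get (h i)))
  else none

/-! ## SL propositions -/

/-- An SL proposition: a set of multisets of resources. -/
abbrev SLProp (Qubit Var Val : Type) : Type 1 := Set (MSet (Res Qubit Var Val))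


/-- Entailment of SL propositions: set inclusion. -/
def entails (P Q : SLProp Qubit Var Val) : Prop := P ⊆ Q

/-- Separating conjunction. -/
def star (P Q : SLProp Qubit Var Val) : SLProp Qubit Var Val :=
  { m | ∃ mp ∈ P, ∃ mq ∈ Q, mprodM mp mq = some m }

/-- Sum of SL propositions: all defined sums `m +_r m'` over `m ∈ P`, `m' ∈ Q`
and multiset bijections `r` between `m` and `m'`. -/
def propSum (P Q : SLProp Qubit Var Val) : SLProp Qubit Var Val :=
  { m | ∃ r : MSet (Res Qubit Var Val × Res Qubit Var Val),
      MSet.map Prod.fst r ∈ P ∧ MSet.map Prod.snd r ∈ Q ∧ msumr r = some m }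

/-- Indexed bare mixing. -/
def bigMix (I : Type) (P : I → SLProp Qubit Var Val) : SLProp Qubit Var Val :=
  { m | ∃ f : I → MSet (Res Qubit Var Val), (∀ x, f x ∈ P x) ∧ m = MSet.biguplus I f }

/-- Binary bare mixing, the case of `bigMix` over a two-element index set. -/
def binMix (P Q : SLProp Qubit Var Val) : SLProp Qubit Var Val :=
  bigMix Bool (fun b => if b then Q else P)

/-- Precision: any two multisets in `P` are equal. -/
def precise (P : SLProp Qubit Var Val) : Prop := ∀ m ∈ P, ∀ m' ∈ P, m = m'

/-- Non-emptiness of behaviours: every multiset in `P` is nonempty. -/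
def nonnb (P : SLProp Qubit Var Val) : Prop := ∀ m ∈ P, Nonempty (MSet.out m).idx

/-- Unambiguity: any two occurrences at distinct indices are incompatible. -/
def unambig (P : SLProp Qubit Var Val) : Prop :=
  ∀ m ∈ P, ∀ i j : (MSet.out m).idx, i ≠ j → incompat (m.out.val i) (m.out.val j)

/-- Incompatibility of SL propositions: every occurrence of every `m ∈ P` is
incompatible with every occurrence of every `m' ∈ Q`. -/
def propIncompat (P Q : SLProp Qubit Var Val) : Prop :=
  ∀ m ∈ P, ∀ m' ∈ Q, ∀ (i : (MSet.out m).idx) (j : (MSet.out m').idx),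
    incompat (m.out.val i) (m'.out.val j)

/-- The singleton proposition of the one-element multiset of a resource. -/
def singletonProp (a : Res Qubit Var Val) : SLProp Qubit Var Val :=
  { m | m = MSet.mk PUnit (fun _ => a) }

/-- The points-to proposition `ι ↦ v`: empty quantum state (scalar 1) and the
store mapping only `ι` to `v`. -/
def varPoints (ι : Var) (v : Val) : SLProp Qubit Var Val :=
  singletonProp (unitQ, fun y => if y = ι then some v else none)

/-- Tagged mixing over an index set of values. -/
def taggedMix (ι : Var) (I : Set Val) (P : Val → SLProp Qubit Var Val) :
    SLProp Qubit Var Val :=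
  bigMix I (fun x => star (varPoints ι x.1) (P x.1))

theorem mk_eq {A I J : Type} {f : I → A} {g : J → A} (e : I ≃ J) (h : ∀ i, f i = g (e i)) :
    MSet.mk I f = MSet.mk J g := Quotient.sound ⟨e, h⟩

theorem out_mk {A I : Type} (f : I → A) :
    ∃ e : (MSet.mk I f).out.idx ≃ I, ∀ i, (MSet.mk I f).out.val i = f (e i) :=
  Quotient.mk_out (s := msetSetoid A) ⟨I, f⟩

theorem exists_mk {A : Type} (m : MSet A) : ∃ (I : Type) (f : I → A), m = MSet.mk I f :=
  ⟨m.out.idx, m.out.val, (Quotient.out_eq m).symm⟩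

theorem map_mk {A B I : Type} (F : A → B) (f : I → A) :
    MSet.map F (MSet.mk I f) = MSet.mk I (fun i => F (f i)) := by
  obtain ⟨e, he⟩ := out_mk f
  exact mk_eq e fun i => by rw [he]

theorem mprodM_mk {I J : Type} {f : I → Res Qubit Var Val} {g : J → Res Qubit Var Val}
    {k : I × J → Res Qubit Var Val} (h : ∀ p, rmul (f p.1) (g p.2) = some (k p)) :
    mprodM (MSet.mk I f) (MSet.mk J g) = some (MSet.mk (I × J) k) := by
  obtain ⟨e, he⟩ := out_mk f
  obtain ⟨e', he'⟩ := out_mk g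
  have hh : ∀ i j, rmul ((MSet.mk I f).out.val i) ((MSet.mk J g).out.val j)
      = some (k (e i, e' j)) := fun i j => by rw [he, he']; exact h (e i, e' j)
  unfold mprodM
  rw [dif_pos (fun i j => by rw [hh]; rfl)]
  refine congrArg some (mk_eq (Equiv.prodCongr e e') fun p => ?_)
  exact Option.get_of_eq_some _ (hh p.1 p.2)

theorem msumr_mk {I : Type} {f : I → Res Qubit Var Val × Res Qubit Var Val}
    {k : I → Res Qubit Var Val} (h : ∀ p, radd (f p).1 (f p).2 = some (k p)) :
    msumr (MSet.mk I f) = some (MSet.mk I k) := by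
  obtain ⟨e, he⟩ := out_mk f
  have hh : ∀ i, radd ((MSet.mk I f).out.val i).1 ((MSet.mk I f).out.val i).2
      = some (k (e i)) := fun i => by rw [he]; exact h (e i)
  unfold msumr
  rw [dif_pos (fun i => by rw [hh]; rfl)]
  refine congrArg some (mk_eq e fun p => ?_)
  exact Option.get_of_eq_some _ (hh p)

theorem mprodM_inv {I J : Type} {f : I → Res Qubit Var Val} {g : J → Res Qubit Var Val}
    {m : MSet (Res Qubit Var Val)} (h : mprodM (MSet.mk I f) (MSet.mk J g) = some m) :
    ∃ k : I × J → Res Qubit Var Val,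
      (∀ p, rmul (f p.1) (g p.2) = some (k p)) ∧ m = MSet.mk (I × J) k := by
  obtain ⟨e, he⟩ := out_mk f
  obtain ⟨e', he'⟩ := out_mk g
  have h0 : ∀ p : I × J, ∃ x, rmul (f p.1) (g p.2) = some x := by
    intro p
    unfold mprodM at h
    split_ifs at h with hd
    have := hd (e.symm p.1) (e'.symm p.2)
    rw [he, he', Equiv.apply_symm_apply, Equiv.apply_symm_apply] at this
    exact Option.isSome_iff_exists.1 this
  choose k hk using h0
  exact ⟨k, hk, (Option.some.inj ((mprodM_mk hk).symm.trans h)).symm⟩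

theorem msumr_inv {I : Type} {f : I → Res Qubit Var Val × Res Qubit Var Val}
    {m : MSet (Res Qubit Var Val)} (h : msumr (MSet.mk I f) = some m) :
    ∃ k : I → Res Qubit Var Val,
      (∀ p, radd (f p).1 (f p).2 = some (k p)) ∧ m = MSet.mk I k := by
  obtain ⟨e, he⟩ := out_mk f
  have h0 : ∀ p : I, ∃ x, radd (f p).1 (f p).2 = some x := by
    intro p
    unfold msumr at h
    split_ifs at h with hd
    have := hd (e.symm p)
    rw [he, Equiv.apply_symm_apply] at this
    exact Option.isSome_iff_exists.1 this
  choose k hk using h0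
  exact ⟨k, hk, (Option.some.inj ((msumr_mk hk).symm.trans h)).symm⟩

theorem rdistrib {a b c s l : Res Qubit Var Val} (h : radd a b = some s)
    (h' : rmul s c = some l) :
    ∃ z : Res Qubit Var Val × Res Qubit Var Val,
      rmul a c = some z.1 ∧ rmul b c = some z.2 ∧ radd z.1 z.2 = some l := by
  obtain ⟨⟨A, v⟩, σ⟩ := a
  obtain ⟨⟨B, w⟩, τ⟩ := b
  unfold radd at h
  split_ifs at h with hd
  obtain ⟨h1, h2⟩ := hd
  dsimp only at h1 h2
  subst h1 h2
  obtain rfl := Option.some.inj h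
  unfold rmul at h'
  split_ifs at h' with hd
  obtain rfl := Option.some.inj h'
  refine ⟨(_, _), dif_pos hd, dif_pos hd, ?_⟩
  unfold radd
  refine (dif_pos ⟨rfl, rfl⟩).trans ?_
  congr 3
  funext f
  exact (add_mul _ _ _).symm

/-- Sum-frame entailment: `(P + Q) * R ⊢ (P * R) + (Q * R)`. -/
theorem sum_frame {Qubit Var Val : Type} (P Q R : SLProp Qubit Var Val) :
    entails (star (propSum P Q) R) (propSum (star P R) (star Q R)) := by
  rintro m ⟨s, ⟨r, hP, hQ, hs⟩, n, hR, hm⟩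
  obtain ⟨I, f, rfl⟩ := exists_mk r
  obtain ⟨J, g, rfl⟩ := exists_mk n
  obtain ⟨k, hk, rfl⟩ := msumr_inv hs
  obtain ⟨l, hl, rfl⟩ := mprodM_inv hm
  have := fun p : I × J => rdistrib (hk p.1) (hl p)
  choose z h1 h2 h3 using this
  rw [map_mk] at hP hQ
  refine ⟨MSet.mk (I × J) z, ?_, ?_, msumr_mk h3⟩
  · rw [map_mk]
    exact ⟨_, hP, _, hR, mprodM_mk h1⟩
  · rw [map_mk]
    exact ⟨_, hQ, _, hR, mprodM_mk h2⟩
end QSL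
end
end

section
/- Probability of orthogonal superpositions (orth-prob): let P and Q be SL propositions with P : Prob p and Q : Prob p, suppose P ⊥ Q, and let α, β be complex numbers with |α|² + |β|² = 1. Then (α·P) + (β·Q) : Prob p. -/
open scoped Classical

noncomputable section

namespace QSL

variable {Qubit Var Val : Type}

/-! ## Inner product, orthogonality and probability -/


/-- Squared norm of a quantum state. -/
def normSqQ (q : QState Qubit) : ℝ :=
  ∑ f : ({ x // x ∈ q.1 } → Bool), Complex.normSq (q.2 f)

/-- Inner product of resources: defined iff the two resources have the same
qubit set and the same store; then the Hermitian inner product of the vectors. -/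
def iprodRes (a b : Res Qubit Var Val) : Option ℂ :=
  if h : a.1.1 = b.1.1 ∧ a.2 = b.2 then
    some (∑ f : ({ x // x ∈ b.1.1 } → Bool),
      (starRingEnd ℂ) (castVec h.1 a.1.2 f) * b.1.2 f)
  else none

/-- Inner product along a multiset bijection (a multiset of pairs): defined iff
every componentwise inner product is defined and the sum converges. -/
def iprodM (r : MSet (Res Qubit Var Val × Res Qubit Var Val)) : Option ℂ :=
  if h : ∀ i, (iprodRes (r.out.val i).1 (r.out.val i).2).isSome then
    if Summable (fun i => (iprodRes (r.out.val i).1 (r.out.val i).2).get (h i)) then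
      some (∑' i, (iprodRes (r.out.val i).1 (r.out.val i).2).get (h i))
    else none
  else none

/-- The set of all defined inner-product values between `P` and `Q`. -/
def iprodProp (P Q : SLProp Qubit Var Val) : Set ℂ :=
  { z | ∃ r, MSet.map Prod.fst r ∈ P ∧ MSet.map Prod.snd r ∈ Q ∧ iprodM r = some z }

/-- `⟨P, Q⟩ : α`. -/
def iprodIs (P Q : SLProp Qubit Var Val) (α : ℂ) : Prop := iprodProp P Q ⊆ {α}

/-- Coherence of SL propositions. -/
def coherent (P Q : SLProp Qubit Var Val) : Prop :=
  ∀ m ∈ P, ∀ m' ∈ Q,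
    ∃ r, MSet.map Prod.fst r = m ∧ MSet.map Prod.snd r = m' ∧ (msumr r).isSome

/-- `lift α`: the singleton proposition of the one-element multiset of the
resource with the empty qubit set, scalar `α`, and empty store. -/
def liftScalar (α : ℂ) : SLProp Qubit Var Val :=
  singletonProp (⟨(∅ : Finset Qubit), fun _ => α⟩, fun _ => none)

/-- Scaling of an SL proposition: `α·P = (lift α) * P`. -/
def scaleProp (α : ℂ) (P : SLProp Qubit Var Val) : SLProp Qubit Var Val :=
  star (liftScalar α) P

/-- `P : Prob p`: every multiset in `P` has total squared norm `p`. -/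
def ProbIs (P : SLProp Qubit Var Val) (p : ℝ) : Prop :=
  ∀ m ∈ P, HasSum (fun i : (MSet.out m).idx => normSqQ (m.out.val i).1) p

theorem mk_out_equiv {A : Type} (I : Type) (f : I → A) :
    ∃ e : (MSet.mk I f).out.idx ≃ I, ∀ i, (MSet.mk I f).out.val i = f (e i) :=
  Quotient.exact (Quotient.out_eq (MSet.mk I f))

theorem mk_out_eq {A : Type} (m : MSet A) : MSet.mk m.out.idx m.out.val = m :=
  Quotient.out_eq m

theorem mk_congr {A : Type} {I J : Type} {f : I → A} {g : J → A} (e : I ≃ J)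
    (h : ∀ i, f i = g (e i)) : MSet.mk I f = MSet.mk J g :=
  Quotient.sound (s := msetSetoid A) ⟨e, h⟩

/-- Scaled resource. -/
def sres (α : ℂ) (b : Res Qubit Var Val) : Res Qubit Var Val :=
  (⟨b.1.1, fun f => α * b.1.2 f⟩, b.2)

theorem qstate_ext {Q' Q : Finset Qubit} (h : Q' = Q) (w : Vec Q') (v : Vec Q)
    (H : ∀ f : ({ q // q ∈ Q' } → Bool), w f = v (fun q => f ⟨q.1, h.symm ▸ q.2⟩)) :
    (⟨Q', w⟩ : QState Qubit) = ⟨Q, v⟩ := by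
  subst h
  have : w = v := funext H
  rw [this]

theorem rmul_lift (α : ℂ) (b : Res Qubit Var Val) :
    rmul (⟨(∅ : Finset Qubit), fun _ => α⟩, fun _ => none) b = some (sres α b) := by
  unfold rmul
  rw [dif_pos ⟨Finset.disjoint_empty_left _, fun x => Or.inl rfl⟩]
  congr 1
  refine Prod.ext ?_ ?_
  · exact qstate_ext (Finset.empty_union _) _ _ (fun f => rfl)
  · funext x
    show (none <|> b.2 x) = b.2 x
    simp

/-- Total inner product. -/
def ip (a b : Res Qubit Var Val) : ℂ := (iprodRes a b).getD 0

theorem normSq_comb (α β x y : ℂ) : Complex.normSq (α * x + β * y) =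
    Complex.normSq α * Complex.normSq x + Complex.normSq β * Complex.normSq y
     + 2 * ((starRingEnd ℂ) α * β * ((starRingEnd ℂ) x * y)).re := by
  simp [Complex.normSq_apply]
  ring

theorem radd_sres (α β : ℂ) (a b c : Res Qubit Var Val)
    (h : radd (sres α a) (sres β b) = some c) :
    (iprodRes a b).isSome ∧ ‖ip a b‖ ≤ normSqQ a.1 + normSqQ b.1 ∧
    normSqQ c.1 = Complex.normSq α * normSqQ a.1 + Complex.normSq β * normSqQ b.1
      + 2 * ((starRingEnd ℂ) α * β * ip a b).re := by
  obtain ⟨⟨A, v⟩, s⟩ := a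
  obtain ⟨⟨B, w⟩, t⟩ := b
  unfold radd at h
  split_ifs at h with hc
  obtain ⟨h1, h2⟩ := hc
  change A = B at h1
  change s = t at h2
  subst h1 h2
  have hip : iprodRes (⟨A, v⟩, s) (⟨A, w⟩, s) =
      some (∑ f : ({ x // x ∈ A } → Bool), (starRingEnd ℂ) (v f) * w f) := by
    unfold iprodRes
    rw [dif_pos ⟨rfl, rfl⟩]
    rfl
  have hip' : ip (⟨A, v⟩, s) (⟨A, w⟩, s) =
      ∑ f : ({ x // x ∈ A } → Bool), (starRingEnd ℂ) (v f) * w f :=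
    congrArg (fun o => o.getD 0) hip
  refine ⟨by rw [hip]; rfl, ?_, ?_⟩
  · rw [hip']
    show ‖∑ f : ({ x // x ∈ A } → Bool), (starRingEnd ℂ) (v f) * w f‖ ≤
      (∑ f : ({ x // x ∈ A } → Bool), Complex.normSq (v f)) +
      ∑ f : ({ x // x ∈ A } → Bool), Complex.normSq (w f)
    rw [← Finset.sum_add_distrib]
    refine norm_sum_le_of_le _ (fun f _ => ?_)
    rw [norm_mul, RCLike.norm_conj, Complex.normSq_eq_norm_sq, Complex.normSq_eq_norm_sq]
    nlinarith [sq_nonneg (‖v f‖ - ‖w f‖), sq_nonneg (‖v f‖), sq_nonneg (‖w f‖)]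
  · rw [hip']
    have h' := Option.some.inj h
    rw [← h']
    show (∑ f : ({ x // x ∈ A } → Bool), Complex.normSq (α * v f + β * w f)) =
      Complex.normSq α * (∑ f : ({ x // x ∈ A } → Bool), Complex.normSq (v f)) +
      Complex.normSq β * (∑ f : ({ x // x ∈ A } → Bool), Complex.normSq (w f)) +
      2 * ((starRingEnd ℂ) α * β *
        ∑ f : ({ x // x ∈ A } → Bool), (starRingEnd ℂ) (v f) * w f).re
    simp only [normSq_comb, Finset.mul_sum, Finset.sum_add_distrib, Complex.re_sum]

theorem scale_mem (α : ℂ) (P : SLProp Qubit Var Val) (I : Type) (g : I → Res Qubit Var Val)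
    (h : MSet.mk I g ∈ scaleProp α P) :
    ∃ f : I → Res Qubit Var Val, MSet.mk I f ∈ P ∧ ∀ i, g i = sres α (f i) := by
  obtain ⟨l, hl, m, hm, h⟩ := h
  change l = _ at hl
  have hex : ∃ e : l.out.idx ≃ PUnit, ∀ i, l.out.val i =
      ((⟨(∅ : Finset Qubit), fun _ => α⟩, fun _ => none) : Res Qubit Var Val) := by
    subst hl
    exact mk_out_equiv _ _
  obtain ⟨e, he⟩ := hex
  unfold mprodM at h
  split_ifs at h with hd
  have h' := Option.some.inj h
  obtain ⟨e2, he2⟩ := Quotient.exact h'.symm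
  change I ≃ l.out.idx × m.out.idx at e2
  have hu : ∀ x y : l.out.idx, x = y := fun x y => e.injective rfl
  let e3 : I ≃ m.out.idx := e2.trans
    ⟨fun p => p.2, fun j => (e.symm PUnit.unit, j),
      fun p => Prod.ext (hu _ _) rfl, fun j => rfl⟩
  refine ⟨fun i => m.out.val (e3 i), ?_, fun i => ?_⟩
  · rw [mk_congr e3 (g := m.out.val) (fun i => rfl), mk_out_eq]
    exact hm
  · have := he2 i
    refine this.trans ?_
    apply Option.get_of_eq_some
    rw [he]
    exact rmul_lift _ _

theorem prob_mk {P : SLProp Qubit Var Val} {p : ℝ} (hP : ProbIs P p) {I : Type}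
    {f : I → Res Qubit Var Val} (h : MSet.mk I f ∈ P) :
    HasSum (fun i => normSqQ (f i).1) p := by
  obtain ⟨e, he⟩ := mk_out_equiv I f
  have := hP _ h
  simp only [he] at this
  exact (e.hasSum_iff (f := fun i => normSqQ (f i).1)).1 this

theorem ip_sum {P Q : SLProp Qubit Var Val} (horth : iprodIs P Q 0) {I : Type}
    {f g : I → Res Qubit Var Val} (hf : MSet.mk I f ∈ P) (hg : MSet.mk I g ∈ Q)
    (hs : ∀ i, (iprodRes (f i) (g i)).isSome) (hsum : Summable fun i => ip (f i) (g i)) :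
    HasSum (fun i => ip (f i) (g i)) 0 := by
  obtain ⟨e, he⟩ := mk_out_equiv I (fun i => (f i, g i))
  have hd : ∀ i, (iprodRes ((MSet.mk I (fun i => (f i, g i))).out.val i).1
      ((MSet.mk I (fun i => (f i, g i))).out.val i).2).isSome := by
    intro i; rw [he]; exact hs _
  have hfun : (fun i => (iprodRes ((MSet.mk I (fun i => (f i, g i))).out.val i).1
      ((MSet.mk I (fun i => (f i, g i))).out.val i).2).get (hd i)) =
      (fun i => ip (f i) (g i)) ∘ e := by
    funext i
    rw [Option.get_eq_getD (fallback := 0), he]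
    rfl
  have hsum' := (e.summable_iff (f := fun i => ip (f i) (g i))).2 hsum
  have hz : (∑' i, ip (f (e i)) (g (e i))) ∈ iprodProp P Q := by
    refine ⟨MSet.mk I (fun i => (f i, g i)), ?_, ?_, ?_⟩
    · have : MSet.map Prod.fst (MSet.mk I (fun i => (f i, g i))) = MSet.mk I f :=
        mk_congr e (fun i => by rw [he])
      rw [this]; exact hf
    · have : MSet.map Prod.snd (MSet.mk I (fun i => (f i, g i))) = MSet.mk I g :=
        mk_congr e (fun i => by rw [he])
      rw [this]; exact hg
    · unfold iprodM
      rw [dif_pos hd, hfun, if_pos hsum']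
      rfl
  have h0 := horth hz
  have h1 := hsum'.hasSum
  rw [show (∑' i, ((fun i => ip (f i) (g i)) ∘ e) i) = 0 from h0] at h1
  exact e.hasSum_iff.1 h1

/-- Probability of orthogonal superpositions: if `P : Prob p`, `Q : Prob p`,
`P ⊥ Q` and `|α|² + |β|² = 1`, then `(α·P) + (β·Q) : Prob p`. -/
theorem orth_prob {Qubit Var Val : Type} (P Q : SLProp Qubit Var Val) (p : ℝ)
    (α β : ℂ) (hP : ProbIs P p) (hQ : ProbIs Q p) (horth : iprodIs P Q 0)
    (hnorm : Complex.normSq α + Complex.normSq β = 1) :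
    ProbIs (propSum (scaleProp α P) (scaleProp β Q)) p := by
  rintro m ⟨r, hr1, hr2, hr⟩
  obtain ⟨f, hf, hf'⟩ := scale_mem α P _ _ hr1
  obtain ⟨g, hg, hg'⟩ := scale_mem β Q _ _ hr2
  unfold msumr at hr
  split_ifs at hr with hd
  have hr' := Option.some.inj hr
  have key : ∀ i, _ := fun i => radd_sres α β (f i) (g i)
    ((radd (r.out.val i).1 (r.out.val i).2).get (hd i))
    (by rw [← hf', ← hg']; exact (Option.some_get _).symm)
  have sP := prob_mk hP hf
  have sQ := prob_mk hQ hg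
  have hsum : Summable fun i => ip (f i) (g i) :=
    Summable.of_norm_bounded (sP.summable.add sQ.summable) (fun i => (key i).2.1)
  have h0 := ip_sum horth hf hg (fun i => (key i).1) hsum
  have h1 := (Complex.hasSum_re (h0.mul_left ((starRingEnd ℂ) α * β))).mul_left 2
  have h2 := ((sP.mul_left (Complex.normSq α)).add (sQ.mul_left (Complex.normSq β))).add h1
  rw [← hr']
  obtain ⟨e, he⟩ := mk_out_equiv r.out.idx
    (fun i => (radd (r.out.val i).1 (r.out.val i).2).get (hd i))
  simp only [he]
  refine (e.hasSum_iff
    (f := fun i => normSqQ ((radd (r.out.val i).1 (r.out.val i).2).get (hd i)).1)).2 ?_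
  rw [funext (fun i => (key i).2.2)]
  have hp : Complex.normSq α * p + Complex.normSq β * p
      + 2 * ((starRingEnd ℂ) α * β * 0).re = p := by
    rw [mul_zero, Complex.zero_re, mul_zero, add_zero, ← add_mul, hnorm, one_mul]
  exact hp ▸ h2
end QSL
end
end
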